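/- Let T > 0 and let u ∈ C(closure(U_T)) ∩ C^{2,1}_{x,t}(U_T) satisfy u ≥ 0 on closure(U_T) and the equation ∂u/∂t = ∇·( X(u, ∇u + u² 𝒵(x,t)) ) in U_T. Then max over closure(U_T) of u equals max over ∂_p U_T of u. -/

import Mathlib

open Real MeasureTheory

noncomputable section

abbrev E3 := EuclideanSpace ℝ (Fin 3)

/-- The cross product `x × y` in `ℝ³`. -/
def cross3 (x y : E3) : E3 :=
  (WithLp.equiv 2 (Fin 3 → ℝ)).symm
    ![x 1 * y 2 - x 2 * y 1, x 2 * y 0 - x 0 * y 2, x 0 * y 1 - x 1 * y 0]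

/-- The function `g(s) = Σ aᵢ s^{ᾱᵢ}` (with `0⁰ = 1`, as for `Real.rpow`). -/
def gFun (N : ℕ) (α' A : Fin (N + 1) → ℝ) (s : ℝ) : ℝ := ∑ i, A i * s ^ α' i

/-- Divergence of a vector field on `ℝ³`. -/
def div3 (F : E3 → E3) (x : E3) : ℝ :=
  ∑ i, fderiv ℝ F x (EuclideanSpace.single i 1) i

theorem inner_E3 (x y : E3) : inner ℝ x y = x 0 * y 0 + x 1 * y 1 + x 2 * y 2 := by
  simp [PiLp.inner_apply, Fin.sum_univ_three, mul_comm]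

/-- The cross product with `k` as a continuous linear map. -/
def cross3CLM (k : E3) : E3 →L[ℝ] E3 :=
  LinearMap.toContinuousLinearMap
    { toFun := cross3 k
      map_add' := fun x y => by
        ext i; fin_cases i <;> simp [cross3] <;> ring
      map_smul' := fun c x => by
        ext i; fin_cases i <;> simp [cross3] <;> ring }

theorem cross3CLM_apply (k x : E3) : cross3CLM k x = cross3 k x := rfl

theorem inner_cross3_left (k x y : E3) :
    inner ℝ (cross3 k x) y = -inner ℝ x (cross3 k y) := by
  simp only [inner_E3]
  simp [cross3]
  ring

theorem inner_cross3_self (k x : E3) : inner ℝ (cross3 k x) x = 0 := by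
  simp only [inner_E3]
  simp [cross3]
  ring

theorem gFun_monotoneOn {N : ℕ} {α' A : Fin (N + 1) → ℝ} (hα : ∀ i, 0 ≤ α' i)
    (hA : ∀ i, 0 ≤ A i) : MonotoneOn (gFun N α' A) (Set.Ici 0) := by
  intro s hs t _ hst
  exact Finset.sum_le_sum fun i _ =>
    mul_le_mul_of_nonneg_left (rpow_le_rpow hs hst (hα i)) (hA i)

theorem gFun_nonneg {N : ℕ} {α' A : Fin (N + 1) → ℝ} (hA : ∀ i, 0 ≤ A i) {s : ℝ}
    (hs : 0 ≤ s) : 0 ≤ gFun N α' A s :=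
  Finset.sum_nonneg fun i _ => mul_nonneg (hA i) (rpow_nonneg hs _)

/-- A radial field `v ↦ g(‖v‖) v` with `g` nonnegative and nondecreasing is monotone. -/
theorem inner_radial_sub_nonneg {E : Type*} [NormedAddCommGroup E] [InnerProductSpace ℝ E]
    {g : ℝ → ℝ} (hg : MonotoneOn g (Set.Ici 0)) (hg0 : ∀ s, 0 ≤ s → 0 ≤ g s) (v w : E) :
    0 ≤ inner ℝ (v - w) (g ‖v‖ • v - g ‖w‖ • w) := by
  have hexp : inner ℝ (v - w) (g ‖v‖ • v - g ‖w‖ • w)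
      = g ‖v‖ * ‖v‖ ^ 2 + g ‖w‖ * ‖w‖ ^ 2 - (g ‖v‖ + g ‖w‖) * inner ℝ v w := by
    simp only [inner_sub_left, inner_sub_right, real_inner_smul_right,
      real_inner_self_eq_norm_sq, real_inner_comm v w]
    ring
  have hcs := mul_le_mul_of_nonneg_left (real_inner_le_norm v w)
    (add_nonneg (hg0 _ (norm_nonneg v)) (hg0 _ (norm_nonneg w)))
  have hmono : 0 ≤ (‖v‖ - ‖w‖) * (g ‖v‖ * ‖v‖ - g ‖w‖ * ‖w‖) := by
    rcases le_total ‖v‖ ‖w‖ with h | h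
    · exact mul_nonneg_of_nonpos_of_nonpos (sub_nonpos.2 h) (sub_nonpos.2
        (mul_le_mul (hg (norm_nonneg v) (norm_nonneg w) h) h (norm_nonneg v)
          (hg0 _ (norm_nonneg w))))
    · exact mul_nonneg (sub_nonneg.2 h) (sub_nonneg.2
        (mul_le_mul (hg (norm_nonneg w) (norm_nonneg v) h) h (norm_nonneg w)
          (hg0 _ (norm_nonneg v))))
  rw [hexp]
  nlinarith

/-- The derivative of a monotone vector field has nonnegative quadratic form. -/
theorem inner_fderiv_nonneg_of_monotone {E : Type*} [NormedAddCommGroup E]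
    [InnerProductSpace ℝ E] {F : E → E} {F' : E →L[ℝ] E} {y : E} (hF : HasFDerivAt F F' y)
    (hmono : ∀ a b, 0 ≤ inner ℝ (F a - F b) (a - b)) (v : E) : 0 ≤ inner ℝ (F' v) v := by
  have hline : HasDerivAt (fun s : ℝ => y + s • v) v 0 := by
    simpa using ((hasDerivAt_id (0 : ℝ)).smul_const v).const_add y
  have hcomp : HasDerivAt (fun s : ℝ => F (y + s • v)) (F' v) 0 :=
    HasFDerivAt.comp_hasDerivAt (0 : ℝ) (by simpa using hF) hline
  have hin : HasDerivAt (fun s : ℝ => inner ℝ (F (y + s • v)) v) (inner ℝ (F' v) v) 0 := by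
    simpa using hcomp.inner ℝ (hasDerivAt_const (0 : ℝ) v)
  have hslope := hin.tendsto_slope_zero_right
  refine ge_of_tendsto hslope ?_
  filter_upwards [self_mem_nhdsWithin] with s hs
  have hs' : 0 < s := hs
  have h := hmono (y + s • v) y
  rw [add_sub_cancel_left, real_inner_smul_right] at h
  have h2 := nonneg_of_mul_nonneg_right h hs'
  simp only [zero_add, zero_smul, add_zero, smul_eq_mul]
  rw [← inner_sub_left]
  positivity

/-- The second-order necessary condition at a local maximum of a function of one variable. -/
theorem deriv_deriv_nonpos_of_isLocalMax {f : ℝ → ℝ} {a : ℝ} (hmax : IsLocalMax f a)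
    (hc : ContinuousAt f a) : deriv (deriv f) a ≤ 0 := by
  by_contra! hpos
  have hmin := isLocalMin_of_deriv_deriv_pos hpos hmax.deriv_eq_zero hc
  have hconst : f =ᶠ[nhds a] fun _ => f a := by
    filter_upwards [hmax, hmin] with s h1 h2 using le_antisymm h1 h2
  have := hconst.deriv.deriv_eq
  simp at this
  exact hpos.ne' this

theorem fderiv_fderiv_apply_self_nonpos_of_isLocalMax {E : Type*} [NormedAddCommGroup E]
    [NormedSpace ℝ E] {f : E → ℝ} {x : E} (hmax : IsLocalMax f x) (hf : ContDiffAt ℝ 2 f x)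
    (v : E) : fderiv ℝ (fderiv ℝ f) x v v ≤ 0 := by
  have hline : ∀ s : ℝ, HasDerivAt (fun s : ℝ => x + s • v) v s := fun s => by
    simpa using ((hasDerivAt_id s).smul_const v).const_add x
  have hlim : Filter.Tendsto (fun s : ℝ => x + s • v) (nhds 0) (nhds x) := by
    simpa using (hline 0).continuousAt.tendsto
  have hdiff : ∀ᶠ z in nhds x, DifferentiableAt ℝ f z :=
    (hf.eventually (by simp)).mono fun z hz => hz.differentiableAt (by simp)
  have hd2 : DifferentiableAt ℝ (fderiv ℝ f) x :=
    (hf.fderiv_right (m := 1) (by norm_num)).differentiableAt (by simp)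
  have hderiv : deriv (fun s : ℝ => f (x + s • v)) =ᶠ[nhds 0]
      fun s => fderiv ℝ f (x + s • v) v := by
    filter_upwards [hlim.eventually hdiff] with s hs
    exact (hs.hasFDerivAt.comp_hasDerivAt s (hline s)).deriv
  have h2 : HasDerivAt (fun s : ℝ => fderiv ℝ f (x + s • v) v)
      (fderiv ℝ (fderiv ℝ f) x v v) 0 := by
    have h : HasDerivAt (fun s : ℝ => fderiv ℝ f (x + s • v)) (fderiv ℝ (fderiv ℝ f) x v) 0 :=
      HasFDerivAt.comp_hasDerivAt (0 : ℝ) (by simpa using hd2.hasFDerivAt) (hline 0)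
    simpa using h.clm_apply (hasDerivAt_const (0 : ℝ) v)
  have hmax0 : IsLocalMax (fun s : ℝ => f (x + s • v)) 0 := by
    have := hlim.eventually hmax
    filter_upwards [this] with s hs
    simpa using hs
  have hc0 : ContinuousAt (fun s : ℝ => f (x + s • v)) 0 :=
    ContinuousAt.comp (by simpa using hf.continuousAt) (hline 0).continuousAt
  have := deriv_deriv_nonpos_of_isLocalMax hmax0 hc0
  rwa [hderiv.deriv_eq, h2.deriv] at this

/-- The trace of `L B` is nonpositive when `L` has nonnegative quadratic form and `B` is symmetric
with nonpositive quadratic form. -/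
theorem sum_inner_comp_nonpos {E ι : Type*} [NormedAddCommGroup E] [InnerProductSpace ℝ E]
    [FiniteDimensional ℝ E] [Fintype ι] (b : OrthonormalBasis ι ℝ E) {L B : E →ₗ[ℝ] E}
    (hL : ∀ v, 0 ≤ inner ℝ (L v) v) (hB : B.IsSymmetric) (hB0 : ∀ v, inner ℝ (B v) v ≤ 0) :
    ∑ i, inner ℝ (b i) (L (B (b i))) ≤ 0 := by
  have h1 := LinearMap.trace_eq_sum_inner (L ∘ₗ B) b
  have h2 := LinearMap.trace_eq_sum_inner (L ∘ₗ B) (hB.eigenvectorBasis rfl)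
  simp only [LinearMap.comp_apply] at h1 h2
  rw [← h1, h2]
  refine Finset.sum_nonpos fun i _ => ?_
  have hev := hB.apply_eigenvectorBasis rfl i
  have hneg := hB0 (hB.eigenvectorBasis rfl i)
  rw [hev] at hneg ⊢
  rw [real_inner_smul_left, real_inner_self_eq_norm_sq] at hneg
  simp only [OrthonormalBasis.norm_eq_one, one_pow, mul_one, RCLike.ofReal_real_eq_id, id] at hneg
  rw [map_smul, real_inner_smul_right, real_inner_comm]
  exact mul_nonpos_of_nonpos_of_nonneg hneg (hL _)

/-- The left derivative of a function at a maximum over `[a, b]`, at a point of `(a, b]`, is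
nonnegative. -/
theorem hasDerivAt_nonneg_of_isMaxOn_Icc {f : ℝ → ℝ} {f' a b t : ℝ} (hf : HasDerivAt f f' t)
    (ht : t ∈ Set.Ioc a b) (hmax : ∀ s ∈ Set.Icc a b, f s ≤ f t) : 0 ≤ f' := by
  refine ge_of_tendsto (hf.tendsto_slope.mono_left
    (nhdsWithin_mono t fun s (hs : s ∈ Set.Iio t) => ne_of_lt hs)) ?_
  filter_upwards [Ioo_mem_nhdsLT ht.1] with s hs
  rw [slope_def_field]
  exact div_nonneg_of_nonpos (sub_nonpos.2 (hmax s ⟨hs.1.le, hs.2.le.trans ht.2⟩))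
    (sub_nonpos.2 hs.2.le)

theorem div3_eq_sum_inner (F : E3 → E3) (x : E3) :
    div3 F x = ∑ i, inner ℝ (EuclideanSpace.basisFun (Fin 3) ℝ i)
      (fderiv ℝ F x (EuclideanSpace.basisFun (Fin 3) ℝ i)) := by
  simp [div3, EuclideanSpace.inner_single_left]

/-- At an interior spatial maximum the diffusion operator is nonpositive. -/
theorem div3_nonpos_of_isLocalMax {X : ℝ → E3 → E3}
    (hXC1 : ContDiff ℝ 1 (fun p : ℝ × E3 => X p.1 p.2))
    (hmono : ∀ z a b, 0 ≤ inner ℝ (X z a - X z b) (a - b)) {f : E3 → ℝ} {x : E3}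
    (hmax : IsLocalMax f x) (hf : ContDiffAt ℝ 2 f x) (c k : E3) (ω : ℝ) :
    div3 (fun x' => X (f x') (gradient f x' + (f x' ^ (2 : ℕ)) •
      (c + (ω ^ (2 : ℕ)) • cross3 k (cross3 k x')))) x ≤ 0 := by
  have hd2 : DifferentiableAt ℝ (fderiv ℝ f) x :=
    (hf.fderiv_right (m := 1) (by norm_num)).differentiableAt (by simp)
  set D := fderiv ℝ (fderiv ℝ f) x with hD
  let S : (E3 →L[ℝ] ℝ) →L[ℝ] E3 :=
    { toFun := (InnerProductSpace.toDual ℝ E3).symm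
      map_add' := map_add _
      map_smul' := fun r ℓ => by simp
      cont := (InnerProductSpace.toDual ℝ E3).symm.continuous }
  have hS : ∀ (ℓ : E3 →L[ℝ] ℝ) v, inner ℝ (S ℓ) v = ℓ v := fun ℓ v =>
    InnerProductSpace.toDual_symm_apply (𝕜 := ℝ) (x := v) (y := ℓ)
  have hgrad : HasFDerivAt (gradient f) (S.comp D) x :=
    S.hasFDerivAt.comp x hd2.hasFDerivAt
  have hf' : HasFDerivAt f (0 : E3 →L[ℝ] ℝ) x := by
    have := (hf.differentiableAt (by simp)).hasFDerivAt
    rwa [hmax.fderiv_eq_zero] at this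
  let K := cross3CLM k
  have hJ : HasFDerivAt (fun x' => c + (ω ^ (2 : ℕ)) • cross3 k (cross3 k x'))
      ((ω ^ (2 : ℕ)) • (K.comp K)) x :=
    ((K.comp K).hasFDerivAt.const_smul (ω ^ (2 : ℕ))).const_add c
  let B : E3 →L[ℝ] E3 := S.comp D + (f x ^ (2 : ℕ)) • (ω ^ (2 : ℕ)) • (K.comp K)
  have hinner : HasFDerivAt (fun x' => gradient f x' + (f x' ^ (2 : ℕ)) •
      (c + (ω ^ (2 : ℕ)) • cross3 k (cross3 k x'))) B x := by
    have := hgrad.add ((hf'.pow 2).smul hJ)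
    refine this.congr_fderiv ?_
    ext v : 1
    simp [B]
  set y := gradient f x + (f x ^ (2 : ℕ)) • (c + (ω ^ (2 : ℕ)) • cross3 k (cross3 k x))
  have hXd : HasFDerivAt (fun p : ℝ × E3 => X p.1 p.2)
      (fderiv ℝ (fun p : ℝ × E3 => X p.1 p.2) (f x, y)) (f x, y) :=
    (hXC1.differentiable (by simp) _).hasFDerivAt
  set X' := fderiv ℝ (fun p : ℝ × E3 => X p.1 p.2) (f x, y)
  let L : E3 →L[ℝ] E3 := X'.comp (ContinuousLinearMap.inr ℝ ℝ E3)
  have hL : HasFDerivAt (fun a => X (f x) a) L y :=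
    hXd.comp y (hasFDerivAt_prodMk_right (f x) y)
  have htot := hXd.comp x (hf'.prodMk hinner)
  rw [div3_eq_sum_inner]
  have hfd := htot.fderiv
  simp only [Function.comp_def] at hfd
  rw [hfd]
  have hBi : ∀ v w, inner ℝ (B v) w = D v w
      - f x ^ 2 * (ω ^ 2 * inner ℝ (cross3 k v) (cross3 k w)) := fun v w => by
    simp [B, K, inner_add_left, real_inner_smul_left, hS, cross3CLM_apply,
      inner_cross3_left k (cross3 k v) w]
    ring
  have hDsymm : ∀ v w, D v w = D w v := fun v w =>
    (hf.isSymmSndFDerivAt (by simp)) v w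
  refine sum_inner_comp_nonpos (EuclideanSpace.basisFun (Fin 3) ℝ)
    (L := (L : E3 →ₗ[ℝ] E3)) (B := (B : E3 →ₗ[ℝ] E3)) ?_ ?_ ?_
  · exact inner_fderiv_nonneg_of_monotone hL (hmono (f x))
  · intro v w
    change inner ℝ (B v) w = inner ℝ v (B w)
    rw [real_inner_comm (B w) v, hBi, hBi, hDsymm v w, real_inner_comm (cross3 k w) (cross3 k v)]
  · intro v
    change inner ℝ (B v) v ≤ 0
    rw [hBi]
    have h1 := fderiv_fderiv_apply_self_nonpos_of_isLocalMax hmax hf v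
    have h2 := real_inner_self_nonneg (x := cross3 k v)
    have h3 : 0 ≤ f x ^ 2 * (ω ^ 2 * inner ℝ (cross3 k v) (cross3 k v)) := by positivity
    linarith

/-- The maximum principle: the maximum of a nonnegative classical solution `u`
of `∂u/∂t = ∇·(X(u, ∇u + u² 𝒵(x,t)))` over `closure (U_T)` equals its maximum
over the parabolic boundary `∂_p U_T = (U × {0}) ∪ (Γ × [0,T])`. -/
theorem stmt18
    (N : ℕ) (hN : 1 ≤ N)
    (α' : Fin (N + 1) → ℝ) (hα0 : α' 0 = 0) (hαmono : StrictMono α')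
    (A : Fin (N + 1) → ℝ) (hA : ∀ i, 0 < A i)
    (k : E3) (hk : ‖k‖ = 1)
    (Rs : ℝ) (hRs : 0 ≤ Rs)
    (X : ℝ → E3 → E3)
    (hX : ∀ z y, gFun N α' A ‖X z y‖ • X z y + (Rs * z) • cross3 k (X z y) = y)
    (hXC1 : ContDiff ℝ 1 (fun p : ℝ × E3 => X p.1 p.2))
    (𝒢 Ω : ℝ) (h𝒢 : 0 ≤ 𝒢) (hΩ : 0 ≤ Ω)
    (e0 : ℝ → E3) (he0c : Continuous e0) (he0 : ∀ t, ‖e0 t‖ = 1)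
    (U : Set E3) (hUo : IsOpen U) (hUb : Bornology.IsBounded U)
    (T : ℝ) (hT : 0 < T)
    (u : E3 → ℝ → ℝ)
    (hu_cont : ContinuousOn (fun q : E3 × ℝ => u q.1 q.2) (closure U ×ˢ Set.Icc 0 T))
    (hu_x : ∀ t ∈ Set.Ioc 0 T, ContDiffOn ℝ 2 (fun x => u x t) U)
    (hu_t : ∀ x ∈ U, ∀ t ∈ Set.Ioc 0 T, DifferentiableAt ℝ (fun τ => u x τ) t)
    (hu_nonneg : ∀ x ∈ closure U, ∀ t ∈ Set.Icc 0 T, 0 ≤ u x t)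
    (hPDE : ∀ x ∈ U, ∀ t ∈ Set.Ioc 0 T,
      deriv (fun τ => u x τ) t
        = div3 (fun x' => X (u x' t)
            (gradient (fun x'' => u x'' t) x'
              + ((u x' t) ^ (2 : ℕ)) •
                ((-𝒢) • e0 t + (Ω ^ (2 : ℕ)) • cross3 k (cross3 k x')))) x) :
    sSup ((fun q : E3 × ℝ => u q.1 q.2) '' (closure U ×ˢ Set.Icc 0 T))
      = sSup ((fun q : E3 × ℝ => u q.1 q.2) ''
          ((U ×ˢ ({0} : Set ℝ)) ∪ (frontier U ×ˢ Set.Icc 0 T))) := by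
  have hαnn : ∀ i, 0 ≤ α' i := fun i => hα0 ▸ hαmono.monotone (Fin.zero_le i)
  have hAnn : ∀ i, 0 ≤ A i := fun i => (hA i).le
  have hmono : ∀ z a b, 0 ≤ inner ℝ (X z a - X z b) (a - b) := by
    intro z a b
    have hdiff : a - b = (gFun N α' A ‖X z a‖ • X z a - gFun N α' A ‖X z b‖ • X z b)
        + (Rs * z) • cross3 k (X z a - X z b) := by
      have hsub : cross3 k (X z a - X z b) = cross3 k (X z a) - cross3 k (X z b) :=
        map_sub (cross3CLM k) _ _
      conv_lhs => rw [← hX z a, ← hX z b]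
      rw [hsub, smul_sub]
      abel
    rw [hdiff, inner_add_right, real_inner_smul_right, real_inner_comm (cross3 k _),
      inner_cross3_self, mul_zero, add_zero]
    exact inner_radial_sub_nonneg (gFun_monotoneOn hαnn hAnn) (fun s hs => gFun_nonneg hAnn hs) _ _
  rcases U.eq_empty_or_nonempty with rfl | ⟨x₁, hx₁⟩
  · simp
  have hcl : closure U = U ∪ frontier U := closure_eq_self_union_frontier U
  have hcomp : IsCompact (closure U ×ˢ Set.Icc 0 T) := hUb.isCompact_closure.prod isCompact_Icc
  have hsub : (U ×ˢ ({0} : Set ℝ)) ∪ (frontier U ×ˢ Set.Icc 0 T) ⊆ closure U ×ˢ Set.Icc 0 T := by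
    rintro ⟨x, t⟩ (⟨hx, ht⟩ | ⟨hx, ht⟩)
    · obtain rfl : t = 0 := ht
      exact ⟨subset_closure hx, le_rfl, hT.le⟩
    · exact ⟨frontier_subset_closure hx, ht⟩
  have hbdd := (hcomp.image_of_continuousOn hu_cont).bddAbove
  have hbddP := hbdd.mono (Set.image_mono hsub)
  have hneP : ((fun q : E3 × ℝ => u q.1 q.2) ''
      ((U ×ˢ ({0} : Set ℝ)) ∪ (frontier U ×ˢ Set.Icc 0 T))).Nonempty :=
    ⟨_, (x₁, 0), Or.inl ⟨hx₁, rfl⟩, rfl⟩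
  refine le_antisymm (csSup_le (hneP.mono (Set.image_mono hsub)) ?_)
    (csSup_le_csSup hbdd hneP (Set.image_mono hsub))
  rintro _ ⟨⟨x, t⟩, ⟨hx, ht⟩, rfl⟩
  by_contra! hlt
  set M := sSup ((fun q : E3 × ℝ => u q.1 q.2) ''
    ((U ×ˢ ({0} : Set ℝ)) ∪ (frontier U ×ˢ Set.Icc 0 T)))
  have hM : ∀ q ∈ (U ×ˢ ({0} : Set ℝ)) ∪ (frontier U ×ˢ Set.Icc 0 T), u q.1 q.2 ≤ M :=
    fun q hq => le_csSup hbddP ⟨q, hq, rfl⟩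
  obtain ⟨ε, hε, hεlt⟩ : ∃ ε > 0, M < u x t - ε * t := by
    refine ⟨(u x t - M) / (2 * T), by have := sub_pos.2 hlt; positivity, ?_⟩
    have h1 : (u x t - M) / (2 * T) * t ≤ (u x t - M) / (2 * T) * T :=
      mul_le_mul_of_nonneg_left ht.2 (by have := sub_pos.2 hlt; positivity)
    have h2 : (u x t - M) / (2 * T) * T = (u x t - M) / 2 := by field_simp
    have h3 : M < u x t := hlt
    linarith
  obtain ⟨⟨x₀, t₀⟩, ⟨hx₀, ht₀⟩, hmax⟩ := hcomp.exists_isMaxOn ⟨(x, t), hx, ht⟩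
    (f := fun q : E3 × ℝ => u q.1 q.2 - ε * q.2) (hu_cont.sub (by fun_prop))
  have hmax' : ∀ y ∈ closure U, ∀ s ∈ Set.Icc 0 T, u y s - ε * s ≤ u x₀ t₀ - ε * t₀ :=
    fun y hy s hs => hmax (show (y, s) ∈ closure U ×ˢ Set.Icc 0 T from ⟨hy, hs⟩)
  have hgt : M < u x₀ t₀ := by
    have := hmax' x hx t ht
    have := mul_nonneg hε.le ht₀.1
    linarith
  have hfr : x₀ ∉ frontier U := fun h => hgt.not_ge (hM (x₀, t₀) (Or.inr ⟨h, ht₀⟩))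
  have hx₀U : x₀ ∈ U := by
    rw [hcl] at hx₀
    exact hx₀.resolve_right hfr
  have ht₀pos : t₀ ∈ Set.Ioc 0 T := by
    refine ⟨lt_of_le_of_ne ht₀.1 fun h => hgt.not_ge (hM (x₀, t₀) (Or.inl ⟨hx₀U, h.symm⟩)), ht₀.2⟩
  have htime : 0 ≤ deriv (fun τ => u x₀ τ) t₀ - ε := by
    refine hasDerivAt_nonneg_of_isMaxOn_Icc (f := fun τ => u x₀ τ - ε * τ) ?_ ht₀pos
      fun s hs => hmax' x₀ hx₀ s hs
    have h := (hu_t x₀ hx₀U t₀ ht₀pos).hasDerivAt.sub ((hasDerivAt_id t₀).const_mul ε)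
    rw [mul_one] at h
    exact h
  have hlocmax : IsLocalMax (fun y => u y t₀) x₀ := by
    filter_upwards [hUo.mem_nhds hx₀U] with y hy
    have := hmax' y (subset_closure hy) t₀ ht₀
    linarith
  have hspace := div3_nonpos_of_isLocalMax hXC1 hmono hlocmax
    ((hu_x t₀ ht₀pos).contDiffAt (hUo.mem_nhds hx₀U)) ((-𝒢) • e0 t₀) k Ω
  rw [← hPDE x₀ hx₀U t₀ ht₀pos] at hspace
  linarith
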